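/- Let X₁, …, X_n be independent standard Gaussian random vectors in ℝ^d with n ≥ d. For each subset S ⊆ [n] with |S| = d, let V_S be the shortest (minimum Euclidean norm) vector in the affine hull of {Xᵢ : i ∈ S} (well defined almost surely). Then there exists an absolute constant c > 0 such that ℙ( max_{S ⊆ [n], |S| = d} ‖V_S‖ ≤ c·(2 + √(n/d)) ) ≥ 1 − 2·e^{−d}. -/

import Mathlib

open MeasureTheory ProbabilityTheory

/-- The standard Gaussian probability measure on `ℝ^d`. -/
noncomputable def stdGaussian (d : ℕ) : Measure (EuclideanSpace ℝ (Fin d)) :=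
  (Measure.pi fun _ : Fin d => gaussianReal 0 1).map
    (MeasurableEquiv.toLp 2 (Fin d → ℝ))

theorem stdGaussian_eq (d : ℕ) :
    _root_.stdGaussian d = ProbabilityTheory.stdGaussian (EuclideanSpace ℝ (Fin d)) :=
  map_pi_eq_stdGaussian

instance isProbabilityMeasure_stdGaussian (d : ℕ) :
    IsProbabilityMeasure (_root_.stdGaussian d) := by
  rw [stdGaussian_eq]; infer_instance

theorem gaussianPDFReal_mul_exp_sq_div_four (x : ℝ) :
    gaussianPDFReal 0 1 x * Real.exp (1 / 4 * x ^ 2) =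
      (Real.sqrt (2 * Real.pi))⁻¹ * Real.exp (-(1 / 4) * x ^ 2) := by
  rw [gaussianPDFReal, mul_assoc, ← Real.exp_add]
  simp only [NNReal.coe_one, mul_one, sub_zero]
  congr 2
  ring

theorem integrable_exp_sq_div_four_gaussianReal :
    Integrable (fun x : ℝ => Real.exp (1 / 4 * x ^ 2)) (gaussianReal 0 1) := by
  rw [gaussianReal_of_var_ne_zero _ one_ne_zero,
    integrable_withDensity_iff_integrable_smul' (measurable_gaussianPDF _ _)
      (ae_of_all _ fun _ => gaussianPDF_lt_top)]
  simp only [toReal_gaussianPDF, smul_eq_mul, gaussianPDFReal_mul_exp_sq_div_four]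
  exact (integrable_exp_neg_mul_sq (by norm_num)).const_mul _

theorem integral_exp_sq_div_four_gaussianReal :
    ∫ x : ℝ, Real.exp (1 / 4 * x ^ 2) ∂(gaussianReal 0 1) = Real.sqrt 2 := by
  rw [integral_gaussianReal_eq_integral_smul one_ne_zero]
  simp only [smul_eq_mul, gaussianPDFReal_mul_exp_sq_div_four]
  rw [integral_const_mul, integral_gaussian, ← Real.sqrt_inv, ← Real.sqrt_mul (by positivity)]
  congr 1
  field_simp
  norm_num

/-- Chernoff bound for the squared norm of a standard Gaussian vector. -/
theorem stdGaussian_real_le_norm_sq (d : ℕ) (s : ℝ) :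
    (_root_.stdGaussian d).real {x | s ≤ ‖x‖ ^ 2} ≤
      Real.exp (-(1 / 4) * s) * Real.sqrt 2 ^ d := by
  have key : ∀ x : Fin d → ℝ,
      Real.exp (1 / 4 * ∑ i, x i ^ 2) = ∏ i, Real.exp (1 / 4 * x i ^ 2) := fun x => by
    rw [← Real.exp_sum, Finset.mul_sum]
  have hmgf : mgf (fun x : Fin d → ℝ => ∑ i, x i ^ 2)
      (Measure.pi fun _ : Fin d => gaussianReal 0 1) (1 / 4) = Real.sqrt 2 ^ d := by
    simp only [mgf, key]
    rw [integral_fintype_prod_eq_pow (f := fun x : ℝ => Real.exp (1 / 4 * x ^ 2)),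
      integral_exp_sq_div_four_gaussianReal, Fintype.card_fin]
  have h := measure_ge_le_exp_mul_mgf (t := 1 / 4)
    (μ := Measure.pi fun _ : Fin d => gaussianReal 0 1)
    (X := fun x : Fin d → ℝ => ∑ i, x i ^ 2) s (by norm_num) (by
      simp only [key]
      exact Integrable.fintype_prod fun _ => integrable_exp_sq_div_four_gaussianReal)
  rw [hmgf] at h
  convert h using 1
  rw [_root_.stdGaussian, map_measureReal_apply (MeasurableEquiv.measurable _)
    (measurableSet_le measurable_const (by fun_prop))]
  simp [EuclideanSpace.real_norm_sq_eq, Set.preimage]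

/-- The normalized sum of `|S|` independent standard Gaussian vectors is standard Gaussian. -/
theorem map_smul_sum_pi_stdGaussian {d n : ℕ} (S : Finset (Fin n)) (hS : S.Nonempty) :
    (Measure.pi fun _ : Fin n => _root_.stdGaussian d).map
      (fun X => (Real.sqrt S.card)⁻¹ • ∑ i ∈ S, X i) = _root_.stdGaussian d := by
  have hcard : (0 : ℝ) < S.card := by exact_mod_cast hS.card_pos
  have hm : Measurable fun X : Fin n → EuclideanSpace ℝ (Fin d) => ∑ i ∈ S, X i := by fun_prop
  have hind : iIndepFun (fun (i : Fin n) (X : Fin n → EuclideanSpace ℝ (Fin d)) => X i)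
      (Measure.pi fun _ : Fin n => _root_.stdGaussian d) :=
    iIndepFun_pi (X := fun _ => id) fun _ => aemeasurable_id
  have : IsProbabilityMeasure ((Measure.pi fun _ : Fin n => _root_.stdGaussian d).map
      (fun X => (Real.sqrt S.card)⁻¹ • ∑ i ∈ S, X i)) :=
    Measure.isProbabilityMeasure_map (Measurable.aemeasurable (by fun_prop))
  refine Measure.ext_of_charFun (funext fun t => ?_)
  rw [charFun_map_smul_comp hm.aemeasurable,
    (hind.restrict S).charFun_map_fun_finsetSum_eq_prod
      fun i _ => (measurable_pi_apply i).aemeasurable]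
  have hmap : ∀ i, (Measure.pi fun _ : Fin n => _root_.stdGaussian d).map (fun X => X i) =
      _root_.stdGaussian d := fun i =>
    (measurePreserving_eval (fun _ : Fin n => _root_.stdGaussian d) i).map_eq
  have hnorm : ‖(Real.sqrt S.card)⁻¹ • t‖ ^ 2 = (S.card : ℝ)⁻¹ * ‖t‖ ^ 2 := by
    rw [norm_smul, mul_pow, norm_inv, inv_pow, Real.norm_eq_abs, sq_abs, Real.sq_sqrt hcard.le]
  have hcard' : (S.card : ℂ) ≠ 0 := by exact_mod_cast hcard.ne'
  simp only [hmap, Finset.prod_const, Pi.pow_apply]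
  rw [stdGaussian_eq, charFun_stdGaussian, charFun_stdGaussian, ← Complex.exp_nat_mul,
    ← Complex.ofReal_pow, hnorm]
  congr 1
  push_cast
  field_simp

/-- The distance from the origin to an affine span is at most the norm of the centroid. -/
theorem infDist_zero_affineSpan_image_le {d n : ℕ} (X : Fin n → EuclideanSpace ℝ (Fin d))
    (S : Finset (Fin n)) (hS : S.Nonempty) :
    Metric.infDist 0 (affineSpan ℝ (X '' ↑S) : Set (EuclideanSpace ℝ (Fin d))) ≤
      ‖(S.card : ℝ)⁻¹ • ∑ i ∈ S, X i‖ := by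
  have hcard : (S.card : ℝ) ≠ 0 := by exact_mod_cast hS.card_pos.ne'
  rw [← dist_zero_left]
  refine Metric.infDist_le_dist_of_mem ?_
  rw [Finset.smul_sum]
  exact (affineSpan ℝ (X '' ↑S)).convex.sum_mem (fun _ _ => by positivity)
    (by simp [hcard]) fun i hi => subset_affineSpan ℝ _ (Set.mem_image_of_mem X hi)

/-- Lemma: let `X₁, …, X_n` be iid standard Gaussian vectors in `ℝ^d`, `n ≥ d`. For
`S ⊆ [n]` with `|S| = d`, the norm of the shortest vector `V_S` in the affine hull of
`{Xᵢ : i ∈ S}` equals the distance from the origin to that affine hull. There is an absolute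
constant `c > 0` such that
`ℙ(max_S ‖V_S‖ ≤ c (2 + √(n/d))) ≥ 1 - 2 e^{-d}`. -/
theorem stmt17 :
    ∃ c : ℝ, 0 < c ∧
      ∀ d n : ℕ, 1 ≤ d → d ≤ n →
        ENNReal.ofReal (1 - 2 * Real.exp (-(d : ℝ))) ≤
          (Measure.pi fun _ : Fin n => stdGaussian d)
            {X : Fin n → EuclideanSpace ℝ (Fin d) |
              ∀ S : Finset (Fin n), S.card = d →
                Metric.infDist 0
                    (affineSpan ℝ (X '' ↑S) : Set (EuclideanSpace ℝ (Fin d))) ≤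
                  c * (2 + Real.sqrt ((n : ℝ) / (d : ℝ)))} := by
  refine ⟨4, by norm_num, fun d n hd hdn => ?_⟩
  set μ := Measure.pi fun _ : Fin n => _root_.stdGaussian d
  have hd0 : (0 : ℝ) < d := by exact_mod_cast hd
  have hdn' : (d : ℝ) ≤ n := by exact_mod_cast hdn
  let B : Finset (Fin n) → Set (Fin n → EuclideanSpace ℝ (Fin d)) := fun S =>
    {X | 12 * (n : ℝ) ≤ ‖(Real.sqrt S.card)⁻¹ • ∑ i ∈ S, X i‖ ^ 2}
  have hBmeas : ∀ S, MeasurableSet (B S) := fun S =>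
    measurableSet_le measurable_const (by fun_prop)
  have hB : ∀ S ∈ Finset.powersetCard d (Finset.univ : Finset (Fin n)),
      μ.real (B S) ≤ Real.exp (-(1 / 4) * (12 * n)) * Real.sqrt 2 ^ d := by
    intro S hS
    have hne : S.Nonempty := Finset.card_pos.1 (by rw [(Finset.mem_powersetCard.1 hS).2]; omega)
    refine le_trans (le_of_eq ?_) (stdGaussian_real_le_norm_sq d (12 * n))
    rw [← map_smul_sum_pi_stdGaussian S hne, map_measureReal_apply (by fun_prop)
      (measurableSet_le measurable_const (by fun_prop))]
    rfl
  have hUnion : μ.real (⋃ S ∈ Finset.powersetCard d (Finset.univ : Finset (Fin n)), B S) ≤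
      2 * Real.exp (-(d : ℝ)) := by
    refine (measureReal_biUnion_finset_le _ _).trans ((Finset.sum_le_card_nsmul _ _ _ hB).trans ?_)
    rw [Finset.card_powersetCard, Finset.card_univ, Fintype.card_fin, nsmul_eq_mul]
    have hchoose : (n.choose d : ℝ) ≤ Real.exp 1 ^ n := calc
      (n.choose d : ℝ) ≤ 2 ^ n := by exact_mod_cast Nat.choose_le_two_pow n d
      _ ≤ Real.exp 1 ^ n := by
        gcongr
        linarith [Real.add_one_le_exp 1]
    have hsqrt : Real.sqrt 2 ^ d ≤ Real.exp 1 ^ n := calc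
      Real.sqrt 2 ^ d ≤ Real.exp 1 ^ d := by
        gcongr
        exact Real.sqrt_le_iff.2 ⟨by positivity, by nlinarith [Real.add_one_le_exp 1]⟩
      _ ≤ Real.exp 1 ^ n := pow_le_pow_right₀ (Real.one_le_exp zero_le_one) hdn
    calc (n.choose d : ℝ) * (Real.exp (-(1 / 4) * (12 * n)) * Real.sqrt 2 ^ d)
        ≤ Real.exp 1 ^ n * (Real.exp (-(1 / 4) * (12 * n)) * Real.exp 1 ^ n) := by gcongr
      _ = Real.exp (-(n : ℝ)) := by
        rw [← Real.exp_nat_mul, ← Real.exp_add, ← Real.exp_add]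
        congr 1
        ring
      _ ≤ 2 * Real.exp (-(d : ℝ)) := by
        have : Real.exp (-(n : ℝ)) ≤ Real.exp (-(d : ℝ)) := Real.exp_le_exp.2 (by linarith)
        linarith [Real.exp_pos (-(d : ℝ))]
  have hcompl := probReal_compl_eq_one_sub (μ := μ)
    (Finset.measurableSet_biUnion (Finset.powersetCard d (Finset.univ : Finset (Fin n)))
      fun S _ => hBmeas S)
  refine (ENNReal.ofReal_le_ofReal
    (show _ ≤ μ.real (⋃ S ∈ Finset.powersetCard d (Finset.univ : Finset (Fin n)), B S)ᶜ by
      linarith)).trans ?_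
  rw [ofReal_measureReal]
  refine measure_mono fun X hX S hS => ?_
  have hne : S.Nonempty := Finset.card_pos.1 (by omega)
  have hlt : ‖(Real.sqrt d)⁻¹ • ∑ i ∈ S, X i‖ ^ 2 < 12 * (n : ℝ) := by
    by_contra! h
    refine hX (Set.mem_biUnion (x := S) ?_ ?_)
    · simp [hS]
    · simpa [B, hS] using h
  have hsum : ‖∑ i ∈ S, X i‖ ^ 2 ≤ 12 * n * d := by
    rw [norm_smul, mul_pow, norm_inv, inv_pow, Real.norm_eq_abs, sq_abs,
      Real.sq_sqrt hd0.le, inv_mul_lt_iff₀ hd0] at hlt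
    linarith
  refine (infDist_zero_affineSpan_image_le X S hne).trans ?_
  have hbound : ‖(S.card : ℝ)⁻¹ • ∑ i ∈ S, X i‖ ≤ 4 * Real.sqrt ((n : ℝ) / d) := by
    refine abs_le_of_sq_le_sq' ?_ (by positivity) |>.2
    rw [hS, norm_smul, mul_pow, mul_pow, norm_inv, inv_pow, Real.norm_eq_abs, sq_abs,
      Real.sq_sqrt (by positivity), inv_mul_le_iff₀ (by positivity)]
    calc ‖∑ i ∈ S, X i‖ ^ 2 ≤ 12 * n * d := hsum
      _ ≤ 16 * n * d := by gcongr; norm_num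
      _ = (d : ℝ) ^ 2 * (4 ^ 2 * (n / d)) := by field_simp; ring
  linarith
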